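/- arXiv:2412.15096 — 2 statements merged into one kernel-verified Lean document; each statement's English description precedes it below -/
import Mathlib

section
/- Let Γ ⊂ P^n be a nondegenerate finite subscheme of degree d over an algebraically closed field of characteristic 0 such that ⌈(d−n−1)/(t(Γ)+1)⌉ + 3 ≤ reg(Γ) ≤ ⌈(d−n−1)/t(Γ)⌉ + 2, and let H be a hyperplane such that |Γ ∩ H| ≥ n+1 and reg(Γ ∩ H) < reg(Γ). Then reg(Γ : H) ≥ reg(Γ) − 1. -/
open MvPolynomial Filter
open scoped Classical

attribute [local instance] MvPolynomial.gradedAlgebra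

noncomputable section

variable {K : Type} [Field K] {n : ℕ}

/-- The Hilbert function, in degree `m`, of the quotient of the homogeneous
coordinate ring of `ℙ^n_K` by the ideal `I`. -/
def hilbF (I : Ideal (MvPolynomial (Fin (n+1)) K)) (m : ℕ) : ℕ :=
  Module.finrank K
    ((MvPolynomial.homogeneousSubmodule (Fin (n+1)) K m).map
      (Ideal.Quotient.mkₐ K I).toLinearMap)

/-- The irrelevant maximal ideal `(x_0, …, x_n)`. -/
def irrelevantIdeal (K : Type) [Field K] (n : ℕ) : Ideal (MvPolynomial (Fin (n+1)) K) :=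
  Ideal.span (Set.range MvPolynomial.X)

/-- Saturation of a homogeneous ideal with respect to the irrelevant ideal. -/
def saturate (I : Ideal (MvPolynomial (Fin (n+1)) K)) : Ideal (MvPolynomial (Fin (n+1)) K) :=
  ⨆ k : ℕ, Submodule.colon I ((irrelevantIdeal K n ^ k : Ideal (MvPolynomial (Fin (n+1)) K)) : Submodule (MvPolynomial (Fin (n+1)) K) (MvPolynomial (Fin (n+1)) K))

/-- `I` is the (saturated, homogeneous) ideal of a nonempty finite closed subscheme of
`ℙ^n`, i.e. its Hilbert function is eventually a positive constant. -/
structure IsFiniteSubscheme (I : Ideal (MvPolynomial (Fin (n+1)) K)) : Prop where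
  homog : Ideal.IsHomogeneous (MvPolynomial.homogeneousSubmodule (Fin (n+1)) K) I
  saturated : saturate I = I
  finite : ∃ d : ℕ, 0 < d ∧ ∀ᶠ m : ℕ in atTop, hilbF I m = d

/-- The degree (length) of the finite scheme with ideal `I` : the eventual value of
its Hilbert function. -/
def schemeDeg (I : Ideal (MvPolynomial (Fin (n+1)) K)) : ℕ :=
  if h : ∃ d : ℕ, ∀ᶠ m : ℕ in atTop, hilbF I m = d then h.choose else 0

/-- The Castelnuovo–Mumford regularity of the finite scheme with ideal `I` : the least
`p ≥ 1` such that the scheme is `(p-1)`-normal (for a finite scheme, `p`-regularity is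
equivalent to `(p-1)`-normality). -/
def schemeReg (I : Ideal (MvPolynomial (Fin (n+1)) K)) : ℕ :=
  sInf {p : ℕ | 1 ≤ p ∧ ∀ m : ℕ, p - 1 ≤ m → hilbF I m = schemeDeg I}

/-- `h¹(ℙ^n, I_Γ(q))` for a finite scheme `Γ` and `q ≥ 0`: the failure of `q`-normality,
`deg Γ - h_Γ(q)`. -/
def h1F (I : Ideal (MvPolynomial (Fin (n+1)) K)) (q : ℕ) : ℕ :=
  schemeDeg I - hilbF I q

/-- `J` is the ideal of a `t`-dimensional linear subspace of `ℙ^n`: it is generated by a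
space of linear forms of codimension... i.e. of `K`-dimension `n - t`. -/
def IsLinearSubspace (J : Ideal (MvPolynomial (Fin (n+1)) K)) (t : ℕ) : Prop :=
  ∃ W : Submodule K (MvPolynomial (Fin (n+1)) K),
    W ≤ MvPolynomial.homogeneousSubmodule (Fin (n+1)) K 1 ∧
    Module.finrank K W + t = n ∧
    J = Ideal.span (W : Set (MvPolynomial (Fin (n+1)) K))

/-- The ideal of the scheme-theoretic intersection (defined by the sum of the ideal
sheaves): the saturation of `I + J`. -/
def interIdeal (I J : Ideal (MvPolynomial (Fin (n+1)) K)) : Ideal (MvPolynomial (Fin (n+1)) K) :=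
  saturate (I ⊔ J)

/-- The residual scheme `Γ : V`, where `V` is the hypersurface `{f = 0}`, is defined by
the colon ideal `(I_Γ : f)`. -/
def residualIdeal (I : Ideal (MvPolynomial (Fin (n+1)) K)) (f : MvPolynomial (Fin (n+1)) K) :
    Ideal (MvPolynomial (Fin (n+1)) K) :=
  Submodule.colon I (Ideal.span {f})

/-- `Γ` admits a `(t+2)`-secant `t`-plane. -/
def HasSecantPlane (I : Ideal (MvPolynomial (Fin (n+1)) K)) (t : ℕ) : Prop :=
  ∃ J : Ideal (MvPolynomial (Fin (n+1)) K),
    IsLinearSubspace J t ∧ t + 2 ≤ schemeDeg (interIdeal I J)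

/-- `t(Γ)`: the smallest `t` such that `Γ` admits a `(t+2)`-secant `t`-plane. -/
def tInv (I : Ideal (MvPolynomial (Fin (n+1)) K)) : ℕ :=
  sInf {t : ℕ | HasSecantPlane I t}

/-- `Γ` is in linearly general position if `t(Γ) = n`. -/
def InLinGenPos (I : Ideal (MvPolynomial (Fin (n+1)) K)) : Prop :=
  tInv I = n

/-- `Γ ⊆ ℙ^n` is nondegenerate: `I(Γ)` contains no nonzero linear form. -/
def NondegenerateScheme (I : Ideal (MvPolynomial (Fin (n+1)) K)) : Prop :=
  Submodule.restrictScalars K I ⊓ MvPolynomial.homogeneousSubmodule (Fin (n+1)) K 1 = ⊥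

/-- The (projective) dimension of the linear span `⟨Γ⟩` of the scheme with ideal `I`:
`n` minus the number of independent linear forms in `I`. -/
def spanDim (I : Ideal (MvPolynomial (Fin (n+1)) K)) : ℕ :=
  n - Module.finrank K
    ↥(Submodule.restrictScalars K I ⊓ MvPolynomial.homogeneousSubmodule (Fin (n+1)) K 1)

/-- `Γ ∩ Λ` is nondegenerate as a subscheme of the `t`-plane `Λ`: it is contained in no
`(t-1)`-dimensional linear subspace of `Λ`. -/
def NondegenerateIn (I Λ : Ideal (MvPolynomial (Fin (n+1)) K)) (t : ℕ) : Prop :=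
  ∀ J : Ideal (MvPolynomial (Fin (n+1)) K),
    IsLinearSubspace J (t - 1) → Λ ≤ J → ¬ J ≤ interIdeal I Λ

/-- `Γ ∩ Λ` is in linearly general position as a subscheme of the `t`-plane `Λ`: it has
no `(s+2)`-secant `s`-plane inside `Λ` for any `s < t`. -/
def InLinGenPosIn (I Λ : Ideal (MvPolynomial (Fin (n+1)) K)) (t : ℕ) : Prop :=
  ∀ s : ℕ, s < t → ∀ J : Ideal (MvPolynomial (Fin (n+1)) K),
    IsLinearSubspace J s → Λ ≤ J → schemeDeg (interIdeal I J) ≤ s + 1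

/-- `J` is the (saturated) homogeneous ideal of a rational normal curve of degree `t`
in `ℙ^n` : the curve is the image of `ℙ^1` under a parametrization by a basis-spanning
family of binary forms of degree `t`, and `J` is the vanishing ideal of (the affine cone
over) this image. -/
def IsRNC (t : ℕ) (J : Ideal (MvPolynomial (Fin (n+1)) K)) : Prop :=
  ∃ p : Fin (n+1) → MvPolynomial (Fin 2) K,
    (∀ i, (p i).IsHomogeneous t) ∧
    Submodule.span K (Set.range p) = MvPolynomial.homogeneousSubmodule (Fin 2) K t ∧
    J = ⨅ x : Fin 2 → K,
      RingHom.ker (MvPolynomial.eval (fun i => MvPolynomial.eval x (p i)) :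
        MvPolynomial (Fin (n+1)) K →+* K)

/-- `ρ(Γ)`: the maximal length of the intersection of `Γ` with a rational normal curve
(of degree `n`) in `ℙ^n`. -/
def rhoInv (I : Ideal (MvPolynomial (Fin (n+1)) K)) : ℕ :=
  sSup {e : ℕ | ∃ J : Ideal (MvPolynomial (Fin (n+1)) K),
    IsRNC n J ∧ e = schemeDeg (interIdeal I J)}

/-- The (saturated homogeneous) vanishing ideal of a point of `ℙ^n`. -/
def pointIdeal (P : Projectivization K (Fin (n+1) → K)) : Ideal (MvPolynomial (Fin (n+1)) K) :=
  ⨅ c : K, RingHom.ker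
    (MvPolynomial.eval (c • P.rep) : MvPolynomial (Fin (n+1)) K →+* K)

/-- The vanishing ideal of a finite set of points of `ℙ^n`. -/
def idealOfFinset (S : Finset (Projectivization K (Fin (n+1) → K))) :
    Ideal (MvPolynomial (Fin (n+1)) K) :=
  ⨅ P ∈ S, pointIdeal P

/-- A finite set of points of `ℙ^n` is in uniform position if every subset `Y` has
Hilbert function `h_Y(ℓ) = min {|Y|, h_Γ(ℓ)}`. -/
def UniformPosition (S : Finset (Projectivization K (Fin (n+1) → K))) : Prop :=
  ∀ Y ⊆ S, ∀ ℓ : ℕ, hilbF (idealOfFinset Y) ℓ = min Y.card (hilbF (idealOfFinset S) ℓ)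

end
section HilbertFunction

variable {K : Type} [Field K] {n : ℕ}

/-- The degree `m` part of an ideal of the polynomial ring. -/
noncomputable def gradedPart (I : Ideal (MvPolynomial (Fin (n+1)) K)) (m : ℕ) :
    Submodule K (MvPolynomial (Fin (n+1)) K) :=
  homogeneousSubmodule (Fin (n+1)) K m ⊓ Submodule.restrictScalars K I

lemma mem_gradedPart {I : Ideal (MvPolynomial (Fin (n+1)) K)} {m : ℕ}
    {p : MvPolynomial (Fin (n+1)) K} :
    p ∈ gradedPart I m ↔ p.IsHomogeneous m ∧ p ∈ I := Iff.rfl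

instance finite_homogeneousSubmodule (m : ℕ) :
    Module.Finite K (homogeneousSubmodule (Fin (n+1)) K m) :=
  Module.Finite.iff_fg.mpr (homogeneousSubmodule_fg _ _ m)

instance finite_gradedPart (I : Ideal (MvPolynomial (Fin (n+1)) K)) (m : ℕ) :
    Module.Finite K (gradedPart I m) :=
  Submodule.finiteDimensional_inf_left _ _

lemma hilbF_add_finrank_gradedPart (I : Ideal (MvPolynomial (Fin (n+1)) K)) (m : ℕ) :
    hilbF I m + Module.finrank K (gradedPart I m) =
      Module.finrank K (homogeneousSubmodule (Fin (n+1)) K m) := by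
  set g := (Ideal.Quotient.mkₐ K I).toLinearMap.domRestrict (homogeneousSubmodule (Fin (n+1)) K m)
    with hg
  have hr : LinearMap.range g =
      (homogeneousSubmodule (Fin (n+1)) K m).map (Ideal.Quotient.mkₐ K I).toLinearMap := by
    rw [hg, LinearMap.range_domRestrict]
  have hk : (LinearMap.ker g).map (homogeneousSubmodule (Fin (n+1)) K m).subtype =
      gradedPart I m := by
    ext p
    simp [hg, mem_gradedPart, Ideal.Quotient.eq_zero_iff_mem]
    tauto
  have h := g.finrank_range_add_finrank_ker
  rw [hr, ← Submodule.finrank_map_subtype_eq, hk] at h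
  exact h

lemma hilbF_anti {I J : Ideal (MvPolynomial (Fin (n+1)) K)} (h : I ≤ J) (m : ℕ) :
    hilbF J m ≤ hilbF I m := by
  have h1 := hilbF_add_finrank_gradedPart I m
  have h2 := hilbF_add_finrank_gradedPart J m
  have h3 : Module.finrank K (gradedPart I m) ≤ Module.finrank K (gradedPart J m) :=
    Submodule.finrank_mono fun p hp => ⟨hp.1, h hp.2⟩
  omega

lemma hilbF_congr {I J : Ideal (MvPolynomial (Fin (n+1)) K)} {m : ℕ}
    (h : ∀ p : MvPolynomial (Fin (n+1)) K, p.IsHomogeneous m → (p ∈ I ↔ p ∈ J)) :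
    hilbF I m = hilbF J m := by
  have h1 := hilbF_add_finrank_gradedPart I m
  have h2 := hilbF_add_finrank_gradedPart J m
  have h3 : gradedPart I m = gradedPart J m := by
    ext p
    exact and_congr_right fun hp => h p hp
  rw [h3] at h1
  omega

lemma homogeneousComponent_mul_of_le {a b : MvPolynomial (Fin (n+1)) K} {i m : ℕ}
    (ha : a.IsHomogeneous i) (h : i ≤ m) :
    homogeneousComponent m (a * b) = a * homogeneousComponent (m - i) b := by
  have := DirectSum.coe_decompose_mul_of_left_mem_of_le
    (𝒜 := homogeneousSubmodule (Fin (n+1)) K) (b := b) ha h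
  rwa [← decomposition.decompose'_apply, ← decomposition.decompose'_apply]

lemma homogeneousComponent_mul_of_not_le {a b : MvPolynomial (Fin (n+1)) K} {i m : ℕ}
    (ha : a.IsHomogeneous i) (h : ¬ i ≤ m) :
    homogeneousComponent m (a * b) = 0 := by
  have := DirectSum.coe_decompose_mul_of_left_mem_of_not_le
    (𝒜 := homogeneousSubmodule (Fin (n+1)) K) (b := b) ha h
  rwa [← decomposition.decompose'_apply]

lemma isHomogeneous_of_homogeneousComponent_mem {I : Ideal (MvPolynomial (Fin (n+1)) K)}
    (h : ∀ p ∈ I, ∀ i, homogeneousComponent i p ∈ I) :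
    I.IsHomogeneous (homogeneousSubmodule (Fin (n+1)) K) := by
  intro i p hp
  have := h p hp i
  rwa [← decomposition.decompose'_apply] at this

lemma mem_residualIdeal {I : Ideal (MvPolynomial (Fin (n+1)) K)}
    {f g : MvPolynomial (Fin (n+1)) K} : g ∈ residualIdeal I f ↔ g * f ∈ I :=
  Ideal.mem_colon_span_singleton

lemma residualIdeal_isHomogeneous {I : Ideal (MvPolynomial (Fin (n+1)) K)}
    (hI : I.IsHomogeneous (homogeneousSubmodule (Fin (n+1)) K))
    {f : MvPolynomial (Fin (n+1)) K} {k : ℕ} (hf : f.IsHomogeneous k) :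
    (residualIdeal I f).IsHomogeneous (homogeneousSubmodule (Fin (n+1)) K) := by
  refine isHomogeneous_of_homogeneousComponent_mem fun p hp i => ?_
  rw [mem_residualIdeal, mul_comm] at hp ⊢
  have := homogeneousComponent_mem_of_mem hI hp (i + k)
  rwa [homogeneousComponent_mul_of_le hf (by omega), Nat.add_sub_cancel] at this

/-- Additivity of the Hilbert function along
`0 → S/(I : f)(-1) → S/I → S/(I + (f)) → 0` for a linear form `f`. -/
lemma hilbF_succ {I : Ideal (MvPolynomial (Fin (n+1)) K)}
    (hI : I.IsHomogeneous (homogeneousSubmodule (Fin (n+1)) K))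
    {f : MvPolynomial (Fin (n+1)) K} (hf0 : f ≠ 0) (hf : f.IsHomogeneous 1) (m : ℕ) :
    hilbF I (m + 1) = hilbF (residualIdeal I f) m + hilbF (I ⊔ Ideal.span {f}) (m + 1) := by
  have h1 := hilbF_add_finrank_gradedPart I (m + 1)
  have h2 := hilbF_add_finrank_gradedPart (residualIdeal I f) m
  have h3 := hilbF_add_finrank_gradedPart (I ⊔ Ideal.span {f}) (m + 1)
  set μ := LinearMap.mulLeft K f
  have hinj : Function.Injective μ := mul_right_injective₀ hf0
  have hfr (V : Submodule K (MvPolynomial (Fin (n+1)) K)) :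
      Module.finrank K (V.map μ) = Module.finrank K V :=
    (Submodule.equivMapOfInjective μ hinj V).finrank_eq.symm
  have hsup : gradedPart I (m + 1) ⊔ (homogeneousSubmodule (Fin (n+1)) K m).map μ =
      gradedPart (I ⊔ Ideal.span {f}) (m + 1) := by
    apply le_antisymm
    · refine sup_le (fun p hp => ⟨hp.1, Ideal.mem_sup_left hp.2⟩) ?_
      rintro _ ⟨q, hq, rfl⟩
      refine mem_gradedPart.mpr ⟨?_, Ideal.mem_sup_right ?_⟩
      · exact Nat.add_comm 1 m ▸ hf.mul hq
      · exact Ideal.mul_mem_right _ _ (Ideal.mem_span_singleton_self f)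
    · intro p hp
      obtain ⟨hp1, hp2⟩ := mem_gradedPart.mp hp
      obtain ⟨a, ha, b, hb, rfl⟩ := Submodule.mem_sup.mp hp2
      obtain ⟨c, rfl⟩ := Ideal.mem_span_singleton.mp hb
      rw [← homogeneousComponent_eq_self hp1, map_add, homogeneousComponent_mul_of_le hf (by omega)]
      refine Submodule.add_mem_sup (mem_gradedPart.mpr ⟨homogeneousComponent_isHomogeneous _ _,
        homogeneousComponent_mem_of_mem hI ha _⟩) ?_
      exact ⟨_, homogeneousComponent_isHomogeneous _ _, rfl⟩
  have hinf : gradedPart I (m + 1) ⊓ (homogeneousSubmodule (Fin (n+1)) K m).map μ =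
      (gradedPart (residualIdeal I f) m).map μ := by
    ext p
    constructor
    · rintro ⟨hp, q, hq, rfl⟩
      refine ⟨q, mem_gradedPart.mpr ⟨hq, mem_residualIdeal.mpr ?_⟩, rfl⟩
      rw [mul_comm]
      exact hp.2
    · rintro ⟨q, hq, rfl⟩
      obtain ⟨hq1, hq2⟩ := mem_gradedPart.mp hq
      rw [mem_residualIdeal, mul_comm] at hq2
      refine ⟨mem_gradedPart.mpr ⟨?_, hq2⟩, q, hq1, rfl⟩
      exact Nat.add_comm 1 m ▸ hf.mul hq1
  have h4 := Submodule.finrank_sup_add_finrank_inf_eq (gradedPart I (m + 1))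
    ((homogeneousSubmodule (Fin (n+1)) K m).map μ)
  rw [hsup, hinf, hfr, hfr] at h4
  omega

lemma mem_saturate {J : Ideal (MvPolynomial (Fin (n+1)) K)} {g : MvPolynomial (Fin (n+1)) K} :
    g ∈ saturate J ↔ ∃ k : ℕ, ∀ p ∈ irrelevantIdeal K n ^ k, g * p ∈ J := by
  unfold saturate
  rw [Submodule.mem_iSup_of_directed]
  · simp only [Submodule.mem_colon, smul_eq_mul, SetLike.mem_coe]
  · refine (monotone_nat_of_le_succ fun k => ?_).directed_le
    exact Submodule.colon_mono le_rfl (Ideal.pow_le_pow_right k.le_succ)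

lemma le_saturate (J : Ideal (MvPolynomial (Fin (n+1)) K)) : J ≤ saturate J := fun _ hg =>
  mem_saturate.mpr ⟨0, fun _ _ => Ideal.mul_mem_right _ _ hg⟩

lemma saturate_isHomogeneous {J : Ideal (MvPolynomial (Fin (n+1)) K)}
    (hJ : J.IsHomogeneous (homogeneousSubmodule (Fin (n+1)) K)) :
    (saturate J).IsHomogeneous (homogeneousSubmodule (Fin (n+1)) K) := by
  refine isHomogeneous_of_homogeneousComponent_mem fun g hg i => ?_
  obtain ⟨k, hk⟩ := mem_saturate.mp hg
  refine mem_saturate.mpr ⟨k, fun p hp => ?_⟩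
  have hspan := pow_idealOfVars_eq_span (σ := Fin (n+1)) (R := K) k
  have hle : irrelevantIdeal K n ^ k ≤ Submodule.colon J {homogeneousComponent i g} := by
    unfold irrelevantIdeal
    rw [hspan, Ideal.span_le]
    rintro _ ⟨s, hs, rfl⟩
    rw [SetLike.mem_coe, Submodule.mem_colon_singleton, smul_eq_mul]
    have hs' : Finsupp.degree s = k := hs
    have hmon : (monomial s (1 : K)).IsHomogeneous k := isHomogeneous_monomial _ hs'
    have hmem : monomial s (1 : K) ∈ irrelevantIdeal K n ^ k :=
      (monomial_mem_pow_idealOfVars_iff k s one_ne_zero).mpr hs'.ge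
    have := homogeneousComponent_mem_of_mem hJ (mul_comm g _ ▸ hk _ hmem) (i + k)
    rwa [homogeneousComponent_mul_of_le hmon (by omega), Nat.add_sub_cancel] at this
  have := hle hp
  rwa [Submodule.mem_colon_singleton, smul_eq_mul, mul_comm] at this

lemma exists_saturate_mul_mem (J : Ideal (MvPolynomial (Fin (n+1)) K)) :
    ∃ k : ℕ, ∀ g ∈ saturate J, ∀ p ∈ irrelevantIdeal K n ^ k, g * p ∈ J := by
  obtain ⟨k, hk⟩ := monotone_stabilizes_iff_noetherian.mpr
    (inferInstance : IsNoetherian (MvPolynomial (Fin (n+1)) K) (MvPolynomial (Fin (n+1)) K))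
    ⟨fun k => Submodule.colon J ((irrelevantIdeal K n ^ k :
        Ideal (MvPolynomial (Fin (n+1)) K)) : Set (MvPolynomial (Fin (n+1)) K)),
      monotone_nat_of_le_succ fun k =>
        Submodule.colon_mono le_rfl (Ideal.pow_le_pow_right k.le_succ)⟩
  simp only [OrderHom.coe_mk] at hk
  refine ⟨k, fun g hg p hp => ?_⟩
  obtain ⟨l, hl⟩ := mem_saturate.mp hg
  have hgl : g ∈ Submodule.colon J ((irrelevantIdeal K n ^ max k l :
      Ideal (MvPolynomial (Fin (n+1)) K)) : Set (MvPolynomial (Fin (n+1)) K)) :=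
    Submodule.mem_colon.mpr fun q hq => hl q (Ideal.pow_le_pow_right (le_max_right k l) hq)
  rw [← hk _ (le_max_left k l)] at hgl
  exact Submodule.mem_colon.mp hgl p hp

lemma eventually_mem_of_mem_saturate {J : Ideal (MvPolynomial (Fin (n+1)) K)}
    (hJ : J.IsHomogeneous (homogeneousSubmodule (Fin (n+1)) K)) :
    ∀ᶠ m : ℕ in atTop, ∀ p ∈ saturate J, homogeneousComponent m p ∈ J := by
  obtain ⟨k, hk⟩ := exists_saturate_mul_mem J
  obtain ⟨G, hG⟩ : (saturate J).FG := IsNoetherian.noetherian _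
  rw [eventually_atTop]
  refine ⟨k + G.sup totalDegree + 1, fun m hm p hp => ?_⟩
  rw [← hG] at hp
  obtain ⟨a, -, rfl⟩ := Submodule.mem_span_finset.mp hp
  rw [map_sum]
  refine Ideal.sum_mem _ fun g hg => ?_
  have hgM : g ∈ saturate J := hG ▸ Submodule.subset_span hg
  rw [smul_eq_mul, ← sum_homogeneousComponent (a g), Finset.sum_mul, map_sum]
  refine Ideal.sum_mem _ fun i _ => ?_
  have hai := homogeneousComponent_isHomogeneous i (a g)
  by_cases him : i ≤ m
  · rw [homogeneousComponent_mul_of_le hai him]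
    by_cases hik : k ≤ i
    · rw [mul_comm]
      refine hk _ (homogeneousComponent_mem_of_mem (saturate_isHomogeneous hJ) hgM _) _ ?_
      refine (mem_pow_idealOfVars_iff' k _).mpr fun x hx => ?_
      rw [coeff_homogeneousComponent, if_neg (by omega)]
    · have : g.totalDegree ≤ G.sup totalDegree := Finset.le_sup hg
      rw [homogeneousComponent_eq_zero (m - i) g (by omega), mul_zero]
      exact J.zero_mem
  · rw [homogeneousComponent_mul_of_not_le hai him]
    exact J.zero_mem

lemma eventually_hilbF_saturate {J : Ideal (MvPolynomial (Fin (n+1)) K)}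
    (hJ : J.IsHomogeneous (homogeneousSubmodule (Fin (n+1)) K)) :
    ∀ᶠ m : ℕ in atTop, hilbF (saturate J) m = hilbF J m := by
  filter_upwards [eventually_mem_of_mem_saturate hJ] with m hm
  refine hilbF_congr fun p hp => ⟨fun h => ?_, fun h => le_saturate J h⟩
  rw [← homogeneousComponent_eq_self hp]
  exact hm p h

/-- A saturated ideal over an infinite field admits a linear nonzerodivisor on its quotient. -/
lemma exists_linear_nonzerodivisor [Infinite K] {I : Ideal (MvPolynomial (Fin (n+1)) K)}
    (hI : saturate I = I) :
    ∃ l : MvPolynomial (Fin (n+1)) K, l ≠ 0 ∧ l.IsHomogeneous 1 ∧ ∀ g, g * l ∈ I → g ∈ I := by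
  set S := MvPolynomial (Fin (n+1)) K
  set V := homogeneousSubmodule (Fin (n+1)) K 1
  have hfin : (associatedPrimes S (S ⧸ I)).Finite := associatedPrimes.finite S (S ⧸ I)
  let s : Finset (Subspace K V) := insert ⊥ (hfin.toFinset.image fun P =>
    (Submodule.restrictScalars K P).comap V.subtype)
  have hX (i : Fin (n+1)) : X i ∈ V := isHomogeneous_X K i
  have hs : ⊤ ∉ s := by
    intro h
    rcases Finset.mem_insert.mp h with h | h
    · have : (⟨X 0, hX 0⟩ : V) ∈ (⊥ : Subspace K V) := h ▸ Submodule.mem_top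
      rw [Submodule.mem_bot, Subtype.ext_iff] at this
      exact X_ne_zero (R := K) (0 : Fin (n+1)) this
    · obtain ⟨P, hP, hPt⟩ := Finset.mem_image.mp h
      rw [Set.Finite.mem_toFinset, AssociatedPrimes.mem_iff, isAssociatedPrime_iff] at hP
      obtain ⟨hprime, x, hx⟩ := hP
      obtain ⟨y, rfl⟩ := Ideal.Quotient.mk_surjective x
      have hmem {p : S} (hp : p ∈ P) : y * p ∈ I := by
        rw [hx, Submodule.mem_colon_singleton, Submodule.mem_bot] at hp
        rw [← Ideal.Quotient.eq_zero_iff_mem, mul_comm]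
        exact hp
      have hXP (i : Fin (n+1)) : (X i : S) ∈ P := by
        have : (⟨X i, hX i⟩ : V) ∈ (Submodule.restrictScalars K P).comap V.subtype :=
          hPt ▸ Submodule.mem_top
        exact this
      have hirr : irrelevantIdeal K n ≤ P := Ideal.span_le.mpr (Set.range_subset_iff.mpr hXP)
      have hy : y ∈ I := by
        rw [← hI]
        refine mem_saturate.mpr ⟨1, fun p hp => hmem (hirr ?_)⟩
        rwa [pow_one] at hp
      refine hprime.ne_top ((Ideal.eq_top_iff_one P).mpr ?_)
      rw [hx, Submodule.mem_colon_singleton, Submodule.mem_bot, one_smul]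
      exact Ideal.Quotient.eq_zero_iff_mem.mpr hy
  obtain ⟨l, hl⟩ := (Set.ne_univ_iff_exists_notMem _).mp (Subspace.biUnion_ne_univ_of_top_notMem hs)
  simp only [Set.mem_iUnion, not_exists] at hl
  refine ⟨l, fun h0 => ?_, l.2, fun g hg => ?_⟩
  · exact hl ⊥ (Finset.mem_insert_self _ _) (Subtype.ext h0)
  · by_contra hgI
    have hz : (l : S) ∈ {r : S | ∃ x : S ⧸ I, x ≠ 0 ∧ r • x = 0} := by
      refine ⟨Ideal.Quotient.mk I g, fun h => hgI (Ideal.Quotient.eq_zero_iff_mem.mp h), ?_⟩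
      rw [mul_comm] at hg
      exact Ideal.Quotient.eq_zero_iff_mem.mpr hg
    rw [← biUnion_associatedPrimes_eq_zero_divisors S (S ⧸ I)] at hz
    obtain ⟨P, hP, hlP⟩ := Set.mem_iUnion₂.mp hz
    exact hl _ (Finset.mem_insert_of_mem
      (Finset.mem_image_of_mem _ (hfin.mem_toFinset.mpr hP))) hlP

lemma hilbF_monotone {I : Ideal (MvPolynomial (Fin (n+1)) K)}
    (hI : I.IsHomogeneous (homogeneousSubmodule (Fin (n+1)) K))
    {l : MvPolynomial (Fin (n+1)) K} (hl0 : l ≠ 0) (hl : l.IsHomogeneous 1)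
    (hreg : ∀ g, g * l ∈ I → g ∈ I) : Monotone (hilbF I) := by
  refine monotone_nat_of_le_succ fun m => ?_
  have hres : residualIdeal I l = I := by
    ext g
    exact mem_residualIdeal.trans ⟨hreg g, Ideal.mul_mem_right _ _⟩
  rw [hilbF_succ hI hl0 hl m, hres]
  exact Nat.le_add_right _ _

lemma schemeDeg_eq {I : Ideal (MvPolynomial (Fin (n+1)) K)} {d : ℕ}
    (h : ∀ᶠ m : ℕ in atTop, hilbF I m = d) : schemeDeg I = d := by
  have hex : ∃ d : ℕ, ∀ᶠ m : ℕ in atTop, hilbF I m = d := ⟨d, h⟩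
  rw [schemeDeg, dif_pos hex]
  obtain ⟨m, h1, h2⟩ := (hex.choose_spec.and h).exists
  exact h1.symm.trans h2

lemma eventually_hilbF_eq_schemeDeg {I : Ideal (MvPolynomial (Fin (n+1)) K)}
    (h : ∃ d : ℕ, ∀ᶠ m : ℕ in atTop, hilbF I m = d) :
    ∀ᶠ m : ℕ in atTop, hilbF I m = schemeDeg I := by
  obtain ⟨d, hd⟩ := h
  rwa [schemeDeg_eq hd]

lemma schemeReg_spec {I : Ideal (MvPolynomial (Fin (n+1)) K)}
    (h : ∃ d : ℕ, ∀ᶠ m : ℕ in atTop, hilbF I m = d) :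
    1 ≤ schemeReg I ∧ ∀ m : ℕ, schemeReg I - 1 ≤ m → hilbF I m = schemeDeg I := by
  obtain ⟨N, hN⟩ := eventually_atTop.mp (eventually_hilbF_eq_schemeDeg h)
  exact Nat.sInf_mem (s := {p : ℕ | 1 ≤ p ∧ ∀ m : ℕ, p - 1 ≤ m → hilbF I m = schemeDeg I})
    ⟨N + 1, by omega, fun m hm => hN m (by omega)⟩

lemma schemeReg_le {I : Ideal (MvPolynomial (Fin (n+1)) K)} {p : ℕ} (hp : 1 ≤ p)
    (h : ∀ m : ℕ, p - 1 ≤ m → hilbF I m = schemeDeg I) : schemeReg I ≤ p :=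
  Nat.sInf_le ⟨hp, h⟩

lemma exists_eventually_eq_of_monotone {u : ℕ → ℕ} (hu : Monotone u) {d : ℕ}
    (hd : ∀ m, u m ≤ d) : ∃ c, ∀ᶠ m in atTop, u m = c := by
  obtain ⟨N, hN⟩ : ∃ N, ∀ m, u m ≤ u N := by
    obtain ⟨_, ⟨N, rfl⟩, hN⟩ := (Set.finite_Iic d |>.subset
      (Set.range_subset_iff.mpr hd)).exists_maximal (Set.range_nonempty u)
    refine ⟨N, fun m => ?_⟩
    rcases le_total (u m) (u N) with h | h
    · exact h
    · exact hN ⟨m, rfl⟩ h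
  exact ⟨u N, eventually_atTop.mpr ⟨N, fun m hm => le_antisymm (hN m) (hu hm)⟩⟩

/-- The regularity of a finite scheme is at most the maximum of the regularity of a hyperplane
section and one more than the regularity of the residual scheme. -/
lemma schemeReg_le_max [Infinite K] {I : Ideal (MvPolynomial (Fin (n+1)) K)}
    (hfin : IsFiniteSubscheme I) {f : MvPolynomial (Fin (n+1)) K} (hf0 : f ≠ 0)
    (hf : f.IsHomogeneous 1) :
    schemeReg I ≤
      max (schemeReg (interIdeal I (Ideal.span {f}))) (schemeReg (residualIdeal I f) + 1) := by
  have hI := hfin.homog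
  obtain ⟨l, hl0, hl, hreg⟩ := exists_linear_nonzerodivisor hfin.saturated
  have hmono := hilbF_monotone hI hl0 hl hreg
  have hexI : ∃ d : ℕ, ∀ᶠ m : ℕ in atTop, hilbF I m = d :=
    hfin.finite.imp fun _ h => h.2
  have hevI := eventually_hilbF_eq_schemeDeg hexI
  have hle (m : ℕ) : hilbF I m ≤ schemeDeg I := by
    obtain ⟨N, h1, h2⟩ := (hevI.and (eventually_ge_atTop m)).exists
    exact h1 ▸ hmono h2
  have hsucc := hilbF_succ hI hf0 hf
  have hexR : ∃ c : ℕ, ∀ᶠ m : ℕ in atTop, hilbF (residualIdeal I f) m = c := by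
    refine exists_eventually_eq_of_monotone (d := schemeDeg I)
      (hilbF_monotone (residualIdeal_isHomogeneous hI hf) hl0 hl fun g hg => ?_) fun m => ?_
    · rw [mem_residualIdeal] at hg ⊢
      exact hreg _ (by rwa [mul_right_comm] at hg)
    · have h1 := hsucc m
      have h2 := hle (m + 1)
      omega
  have hevR := eventually_hilbF_eq_schemeDeg hexR
  have hJ : (I ⊔ Ideal.span {f}).IsHomogeneous (homogeneousSubmodule (Fin (n+1)) K) :=
    hI.sup (Ideal.homogeneous_span _ _ (by rintro _ rfl; exact ⟨1, hf⟩))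
  have hevS : ∀ᶠ m : ℕ in atTop, hilbF (interIdeal I (Ideal.span {f})) m =
      schemeDeg I - schemeDeg (residualIdeal I f) := by
    have h : ∀ᶠ m : ℕ in atTop, hilbF (interIdeal I (Ideal.span {f})) (m + 1) =
        schemeDeg I - schemeDeg (residualIdeal I f) := by
      filter_upwards [hevR, (tendsto_add_atTop_nat 1).eventually hevI,
        (tendsto_add_atTop_nat 1).eventually (eventually_hilbF_saturate hJ)] with m h1 h2 h3
      have h4 := hsucc m
      rw [interIdeal, h3]
      omega
    obtain ⟨N, hN⟩ := eventually_atTop.mp h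
    refine eventually_atTop.mpr ⟨N + 1, fun m hm => ?_⟩
    obtain ⟨k, rfl⟩ : ∃ k, m = k + 1 := ⟨m - 1, by omega⟩
    exact hN k (by omega)
  have hexS : ∃ e : ℕ, ∀ᶠ m : ℕ in atTop, hilbF (interIdeal I (Ideal.span {f})) m = e := ⟨_, hevS⟩
  have hdegS := schemeDeg_eq hevS
  obtain ⟨hR1, hR⟩ := schemeReg_spec hexR
  obtain ⟨hS1, hS⟩ := schemeReg_spec hexS
  refine schemeReg_le (by omega) fun m hm => le_antisymm (hle m) ?_
  obtain ⟨k, rfl⟩ : ∃ k, m = k + 1 := ⟨m - 1, by omega⟩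
  have h1 := hsucc k
  have h2 := hR k (by omega)
  have h3 := hS (k + 1) (by omega)
  have h4 : hilbF (interIdeal I (Ideal.span {f})) (k + 1) ≤ hilbF (I ⊔ Ideal.span {f}) (k + 1) :=
    hilbF_anti (le_saturate _) _
  omega

end HilbertFunction


/-- Lemma 3.3.(2). -/
theorem stmt7 (K : Type) [Field K] [IsAlgClosed K] [CharZero K] (n d : ℕ)
    (I : Ideal (MvPolynomial (Fin (n+1)) K))
    (hfin : IsFiniteSubscheme I) (hnd : NondegenerateScheme I)
    (hdeg : schemeDeg I = d)
    (hlow : ⌈((d : ℚ) - n - 1) / ((tInv I : ℚ) + 1)⌉ + 3 ≤ (schemeReg I : ℤ))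
    (hhigh : (schemeReg I : ℤ) ≤ ⌈((d : ℚ) - n - 1) / (tInv I : ℚ)⌉ + 2)
    (f : MvPolynomial (Fin (n+1)) K) (hf0 : f ≠ 0) (hfh : f.IsHomogeneous 1)
    (hsec : n + 1 ≤ schemeDeg (interIdeal I (Ideal.span {f})))
    (hregH : schemeReg (interIdeal I (Ideal.span {f})) < schemeReg I) :
    (schemeReg I : ℤ) - 1 ≤ (schemeReg (residualIdeal I f) : ℤ) := by
  have := schemeReg_le_max hfin hf0 hfh
  omega
end

section
/- Let Γ ⊂ P^n be a nondegenerate finite subscheme of degree d over an algebraically closed field of characteristic 0 such that ⌈(d−n−1)/(t(Γ)+1)⌉ + 3 ≤ reg(Γ) ≤ ⌈(d−n−1)/t(Γ)⌉ + 2, and let H be a hyperplane such that |Γ ∩ H| ≥ n+1 and reg(Γ ∩ H) < reg(Γ). Then |Γ : H| − dim⟨Γ : H⟩ + t(Γ : H) ≤ d − n − 1, where ⟨Γ : H⟩ denotes the linear span of Γ : H. -/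
open MvPolynomial Filter
open scoped Classical

attribute [local instance] MvPolynomial.gradedAlgebra

namespace FiniteScheme

theorem finrank_map_add_finrank_inf_ker {F V W : Type*} [Field F] [AddCommGroup V] [Module F V]
    [AddCommGroup W] [Module F W] (φ : V →ₗ[F] W) (p : Submodule F V) [FiniteDimensional F p] :
    Module.finrank F (p.map φ) + Module.finrank F ↥(p ⊓ LinearMap.ker φ) = Module.finrank F p := by
  have h := (φ.domRestrict p).finrank_range_add_finrank_ker
  have h1 : LinearMap.range (φ.domRestrict p) = p.map φ := by
    ext x; simp
  have h2 : (LinearMap.ker (φ.domRestrict p)).map p.subtype = p ⊓ LinearMap.ker φ := by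
    ext x; simp [and_comm]
  rw [← h1, ← h2, Submodule.finrank_map_subtype_eq]
  exact h

section

variable {K : Type} [Field K] {n : ℕ}

instance finiteDimensional_homogeneousSubmodule (m : ℕ) :
    FiniteDimensional K (homogeneousSubmodule (Fin (n+1)) K m) :=
  Module.Finite.iff_fg.2 (homogeneousSubmodule_fg _ _ m)

theorem ker_mkₐ (I : Ideal (MvPolynomial (Fin (n+1)) K)) :
    LinearMap.ker (Ideal.Quotient.mkₐ K I).toLinearMap = I.restrictScalars K := by
  ext x
  simp [Ideal.Quotient.eq_zero_iff_mem]

theorem hilbF_add_finrank (I : Ideal (MvPolynomial (Fin (n+1)) K)) (m : ℕ) :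
    hilbF I m + Module.finrank K ↥(I.restrictScalars K ⊓ homogeneousSubmodule (Fin (n+1)) K m) =
      Module.finrank K (homogeneousSubmodule (Fin (n+1)) K m) := by
  have h := finrank_map_add_finrank_inf_ker (Ideal.Quotient.mkₐ K I).toLinearMap
    (homogeneousSubmodule (Fin (n+1)) K m)
  rw [ker_mkₐ, inf_comm] at h
  exact h

theorem finrank_homogeneousSubmodule_one :
    Module.finrank K (homogeneousSubmodule (Fin (n+1)) K 1) = n + 1 := by
  rw [homogeneousSubmodule_one_eq_span_X, finrank_span_eq_card]
  · simp
  · exact linearIndependent_X (Fin (n+1)) K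

theorem hilbF_anti {I J : Ideal (MvPolynomial (Fin (n+1)) K)} (h : I ≤ J) (m : ℕ) :
    hilbF J m ≤ hilbF I m := by
  have h1 := hilbF_add_finrank I m
  have h2 := hilbF_add_finrank J m
  have h3 : Module.finrank K ↥(I.restrictScalars K ⊓ homogeneousSubmodule (Fin (n+1)) K m) ≤
      Module.finrank K ↥(J.restrictScalars K ⊓ homogeneousSubmodule (Fin (n+1)) K m) :=
    Submodule.finrank_mono (inf_le_inf_right _ h)
  omega

theorem eventually_hilbF_eq_schemeDeg {I : Ideal (MvPolynomial (Fin (n+1)) K)}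
    (h : ∃ d : ℕ, ∀ᶠ m : ℕ in atTop, hilbF I m = d) :
    ∀ᶠ m : ℕ in atTop, hilbF I m = schemeDeg I := by
  rw [schemeDeg, dif_pos h]
  exact h.choose_spec

theorem eventually_hilbF_eq_schemeDeg_of_pos {I : Ideal (MvPolynomial (Fin (n+1)) K)}
    (h : 0 < schemeDeg I) : ∀ᶠ m : ℕ in atTop, hilbF I m = schemeDeg I := by
  refine eventually_hilbF_eq_schemeDeg ?_
  by_contra h'
  rw [schemeDeg, dif_neg h'] at h
  exact h.false

theorem le_saturate (I : Ideal (MvPolynomial (Fin (n+1)) K)) : I ≤ saturate I :=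
  le_trans Ideal.le_colon (le_iSup (fun k : ℕ => Submodule.colon I
    ((irrelevantIdeal K n ^ k : Ideal (MvPolynomial (Fin (n+1)) K)) :
      Set (MvPolynomial (Fin (n+1)) K))) 0)

theorem colon_irrelevantIdeal_pow_le_saturate (I : Ideal (MvPolynomial (Fin (n+1)) K)) (k : ℕ) :
    Submodule.colon I ((irrelevantIdeal K n ^ k : Ideal (MvPolynomial (Fin (n+1)) K)) :
      Set (MvPolynomial (Fin (n+1)) K)) ≤ saturate I :=
  le_iSup (fun k : ℕ => Submodule.colon I
    ((irrelevantIdeal K n ^ k : Ideal (MvPolynomial (Fin (n+1)) K)) :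
      Set (MvPolynomial (Fin (n+1)) K))) k

theorem mem_residualIdeal {I : Ideal (MvPolynomial (Fin (n+1)) K)}
    {f g : MvPolynomial (Fin (n+1)) K} : g ∈ residualIdeal I f ↔ g * f ∈ I :=
  Ideal.mem_colon_span_singleton

theorem saturate_residualIdeal {I : Ideal (MvPolynomial (Fin (n+1)) K)} (hI : saturate I = I)
    (f : MvPolynomial (Fin (n+1)) K) : saturate (residualIdeal I f) = residualIdeal I f := by
  refine le_antisymm (iSup_le fun k x hx => ?_) (le_saturate _)
  rw [mem_residualIdeal, ← hI]
  refine colon_irrelevantIdeal_pow_le_saturate I k (Submodule.mem_colon.2 fun s hs => ?_)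
  have h := mem_residualIdeal.1 (Submodule.mem_colon.1 hx s hs)
  rw [smul_eq_mul] at h ⊢
  rwa [mul_right_comm]

/-- A saturated ideal over an infinite field admits a linear form which is a nonzerodivisor
modulo the ideal. -/
theorem exists_linear_nonzerodivisor [Infinite K] {I : Ideal (MvPolynomial (Fin (n+1)) K)}
    (hI : saturate I = I) :
    ∃ l : MvPolynomial (Fin (n+1)) K, l.IsHomogeneous 1 ∧ ∀ g, g * l ∈ I → g ∈ I := by
  set S := MvPolynomial (Fin (n+1)) K
  let L := homogeneousSubmodule (Fin (n+1)) K 1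
  have hfin := associatedPrimes.finite S (S ⧸ I)
  let s : Finset (Submodule K L) :=
    hfin.toFinset.image fun P : Ideal S => (P.restrictScalars K).comap L.subtype
  have htop : ⊤ ∉ s := by
    intro h
    obtain ⟨P, hP, hPtop⟩ := Finset.mem_image.1 h
    obtain ⟨hprime, x, hx⟩ := isAssociatedPrime_iff.1 (hfin.mem_toFinset.1 hP)
    obtain ⟨y, rfl⟩ := Ideal.Quotient.mk_surjective x
    have hmem : ∀ g : S, g ∈ P ↔ g * y ∈ I := by
      intro g
      rw [hx, Submodule.mem_colon_singleton, Submodule.mem_bot, ← Ideal.Quotient.eq_zero_iff_mem,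
        map_mul]
      rfl
    have hirr : irrelevantIdeal K n ≤ P := by
      refine Ideal.span_le.2 ?_
      rintro _ ⟨i, rfl⟩
      have : (⟨X i, isHomogeneous_X K i⟩ : L) ∈ (P.restrictScalars K).comap L.subtype := by
        rw [hPtop]; trivial
      exact this
    have hy : y ∈ I := by
      rw [← hI]
      refine colon_irrelevantIdeal_pow_le_saturate I 1 (Submodule.mem_colon.2 fun g hg => ?_)
      rw [pow_one] at hg
      rw [smul_eq_mul, mul_comm]
      exact (hmem g).1 (hirr hg)
    exact hprime.ne_top ((Ideal.eq_top_iff_one _).2 ((hmem 1).2 (by simpa using hy)))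
  obtain ⟨l, hl⟩ := (Set.ne_univ_iff_exists_notMem _).1 (Subspace.biUnion_ne_univ_of_top_notMem htop)
  refine ⟨l, l.2, fun g hg => ?_⟩
  by_contra hgI
  have hzd : (l : S) ∈ ⋃ P ∈ associatedPrimes S (S ⧸ I), (P : Set S) := by
    rw [biUnion_associatedPrimes_eq_zero_divisors]
    refine ⟨Ideal.Quotient.mk I g, fun h => hgI (Ideal.Quotient.eq_zero_iff_mem.1 h), ?_⟩
    rw [← Ideal.Quotient.eq_zero_iff_mem, mul_comm, map_mul] at hg
    exact hg
  apply hl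
  simp only [Set.mem_iUnion] at hzd ⊢
  obtain ⟨P, hP, hlP⟩ := hzd
  exact ⟨_, Finset.mem_image_of_mem _ (hfin.mem_toFinset.2 hP), hlP⟩

theorem homogeneousSubmodule_map_mul_le {g : MvPolynomial (Fin (n+1)) K} {k : ℕ}
    (hg : g.IsHomogeneous k) (m : ℕ) :
    (homogeneousSubmodule (Fin (n+1)) K m).map (LinearMap.mulRight K g) ≤
      homogeneousSubmodule (Fin (n+1)) K (m + k) := by
  rintro _ ⟨x, hx, rfl⟩
  exact IsHomogeneous.mul hx hg

/-- If multiplication by `g` identifies the quotient by `J` with a subspace of the quotient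
by `I`, then the Hilbert function of `J` can be computed inside the quotient by `I`. -/
theorem hilbF_eq_finrank_map_mul {I J : Ideal (MvPolynomial (Fin (n+1)) K)}
    {g : MvPolynomial (Fin (n+1)) K} (h : ∀ x, x ∈ J ↔ x * g ∈ I) (m : ℕ) :
    hilbF J m = Module.finrank K (((homogeneousSubmodule (Fin (n+1)) K m).map
      (LinearMap.mulRight K g)).map (Ideal.Quotient.mkₐ K I).toLinearMap) := by
  rw [← Submodule.map_comp]
  have h1 := finrank_map_add_finrank_inf_ker
    ((Ideal.Quotient.mkₐ K I).toLinearMap ∘ₗ LinearMap.mulRight K g)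
    (homogeneousSubmodule (Fin (n+1)) K m)
  have h2 : LinearMap.ker ((Ideal.Quotient.mkₐ K I).toLinearMap ∘ₗ LinearMap.mulRight K g) =
      J.restrictScalars K := by
    rw [LinearMap.ker_comp, ker_mkₐ]
    ext x
    simp [h]
  have h3 := hilbF_add_finrank J m
  rw [h2, inf_comm] at h1
  omega

theorem hilbF_monotone [Infinite K] {I : Ideal (MvPolynomial (Fin (n+1)) K)}
    (hI : saturate I = I) : Monotone (hilbF I) := by
  obtain ⟨l, hl, hreg⟩ := exists_linear_nonzerodivisor hI
  refine monotone_nat_of_le_succ fun m => ?_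
  rw [hilbF_eq_finrank_map_mul (fun x => ⟨I.mul_mem_right l, hreg x⟩)]
  exact Submodule.finrank_mono (Submodule.map_mono (homogeneousSubmodule_map_mul_le hl m))

/-- The residual exact sequence, as an inequality of Hilbert functions. -/
theorem hilbF_residualIdeal_add_le (I : Ideal (MvPolynomial (Fin (n+1)) K))
    {f : MvPolynomial (Fin (n+1)) K} (hf : f.IsHomogeneous 1) (m : ℕ) :
    hilbF (residualIdeal I f) m + hilbF (interIdeal I (Ideal.span {f})) (m + 1) ≤
      hilbF I (m + 1) := by
  have hle : I ≤ interIdeal I (Ideal.span {f}) := le_sup_left.trans (le_saturate _)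
  have hfJ : f ∈ interIdeal I (Ideal.span {f}) :=
    le_saturate _ (Ideal.mem_sup_right (Ideal.mem_span_singleton_self f))
  let φ := (Ideal.Quotient.factorₐ K hle).toLinearMap
  have hrn := finrank_map_add_finrank_inf_ker φ
    ((homogeneousSubmodule (Fin (n+1)) K (m+1)).map (Ideal.Quotient.mkₐ K I).toLinearMap)
  have hcomp : φ ∘ₗ (Ideal.Quotient.mkₐ K I).toLinearMap =
      (Ideal.Quotient.mkₐ K (interIdeal I (Ideal.span {f}))).toLinearMap := by
    ext x; rfl
  rw [← Submodule.map_comp, hcomp] at hrn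
  rw [hilbF_eq_finrank_map_mul (fun _ => mem_residualIdeal)]
  have hsub : ((homogeneousSubmodule (Fin (n+1)) K m).map (LinearMap.mulRight K f)).map
      (Ideal.Quotient.mkₐ K I).toLinearMap ≤
      (homogeneousSubmodule (Fin (n+1)) K (m+1)).map (Ideal.Quotient.mkₐ K I).toLinearMap ⊓
        LinearMap.ker φ := by
    refine le_inf (Submodule.map_mono (homogeneousSubmodule_map_mul_le hf m)) ?_
    rintro _ ⟨_, ⟨x, -, rfl⟩, rfl⟩
    exact Ideal.Quotient.eq_zero_iff_mem.2 (Ideal.mul_mem_left _ x hfJ)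
  have := Submodule.finrank_mono hsub
  change _ + Module.finrank K _ ≤ Module.finrank K _
  omega

/-- If the Hilbert function of a saturated ideal `I` takes the same value in degrees `1` and
`m + 1`, then that of any larger ideal does not increase from degree `1` to degree `m + 1`. -/
theorem hilbF_le_hilbF_one [Infinite K] {I J : Ideal (MvPolynomial (Fin (n+1)) K)}
    (hI : saturate I = I) (hIJ : I ≤ J) {m : ℕ} (h : hilbF I (1 + m) = hilbF I 1) :
    hilbF J (1 + m) ≤ hilbF J 1 := by
  obtain ⟨l, hl, hreg⟩ := exists_linear_nonzerodivisor hI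
  have hreg' : ∀ k : ℕ, ∀ x, x * l ^ k ∈ I → x ∈ I := by
    intro k
    induction k with
    | zero => intro x hx; simpa using hx
    | succ k ih => intro x hx; exact ih x (hreg _ (by rwa [pow_succ, ← mul_assoc] at hx))
  have hlm : (l ^ m).IsHomogeneous m := by simpa using hl.pow m
  have heq := hilbF_eq_finrank_map_mul
    (fun x => ⟨I.mul_mem_right (l ^ m), hreg' m x⟩) 1
  have hspan := Submodule.eq_of_le_of_finrank_eq
    (Submodule.map_mono (f := (Ideal.Quotient.mkₐ K I).toLinearMap)
      (homogeneousSubmodule_map_mul_le hlm 1)) (heq.symm.trans h.symm)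
  let φ := (Ideal.Quotient.factorₐ K hIJ).toLinearMap
  have hcomp : φ ∘ₗ (Ideal.Quotient.mkₐ K I).toLinearMap =
      (Ideal.Quotient.mkₐ K J).toLinearMap := by
    ext x; rfl
  have hspanJ := congrArg (Submodule.map φ) hspan
  have hmap : ∀ p : Submodule K (MvPolynomial (Fin (n+1)) K),
      (p.map (Ideal.Quotient.mkₐ K I).toLinearMap).map φ =
        p.map (Ideal.Quotient.mkₐ K J).toLinearMap := fun p => by
    rw [← Submodule.map_comp, hcomp]
  rw [hmap, hmap] at hspanJ
  have hmul : (Ideal.Quotient.mkₐ K J).toLinearMap ∘ₗ LinearMap.mulRight K (l ^ m) =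
      LinearMap.mulRight K (Ideal.Quotient.mk J (l ^ m)) ∘ₗ
        (Ideal.Quotient.mkₐ K J).toLinearMap := by
    apply LinearMap.ext
    intro x
    exact map_mul (Ideal.Quotient.mk J) x (l ^ m)
  rw [← Submodule.map_comp, hmul, Submodule.map_comp] at hspanJ
  unfold hilbF
  rw [← hspanJ]
  exact Submodule.finrank_map_le _ _

theorem schemeDeg_le_of_secant [Infinite K] {I J : Ideal (MvPolynomial (Fin (n+1)) K)}
    (hI : saturate I = I) {t : ℕ} (hJ : IsLinearSubspace J t)
    (h : ∀ᶠ m : ℕ in atTop, hilbF I m = hilbF I 1) :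
    schemeDeg (interIdeal I J) ≤ t + 1 := by
  rcases Nat.eq_zero_or_pos (schemeDeg (interIdeal I J)) with h0 | hpos
  · omega
  have hev := eventually_hilbF_eq_schemeDeg_of_pos hpos
  obtain ⟨m, h1, h2⟩ := ((h.and hev).and (eventually_ge_atTop 1)).exists
  obtain ⟨m, rfl⟩ := Nat.exists_eq_add_of_le h2
  have hle := hilbF_le_hilbF_one hI (le_sup_left.trans (le_saturate (I ⊔ J))) h1.1
  change hilbF (interIdeal I J) _ ≤ hilbF (interIdeal I J) _ at hle
  obtain ⟨W, hW, hdim, rfl⟩ := hJ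
  have hWle : W ≤ (interIdeal I (Ideal.span (W : Set _))).restrictScalars K ⊓
      homogeneousSubmodule (Fin (n+1)) K 1 :=
    le_inf (fun x hx => le_saturate _ (Ideal.mem_sup_right (Ideal.subset_span hx))) hW
  have h3 := Submodule.finrank_mono hWle
  have h4 := hilbF_add_finrank (interIdeal I (Ideal.span (W : Set _))) 1
  rw [finrank_homogeneousSubmodule_one] at h4
  have := h1.2
  omega

/-- The invariant `t` of a finite scheme is at most the dimension of its linear span. -/
theorem tInv_le_spanDim [Infinite K] {I : Ideal (MvPolynomial (Fin (n+1)) K)}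
    (hI : saturate I = I) (hfin : ∃ d : ℕ, ∀ᶠ m : ℕ in atTop, hilbF I m = d) :
    tInv I ≤ spanDim I := by
  rcases Set.eq_empty_or_nonempty {t : ℕ | HasSecantPlane I t} with h0 | ⟨t, J, hJ, ht⟩
  · simp [tInv, h0]
  have hev := eventually_hilbF_eq_schemeDeg hfin
  have hmono := hilbF_monotone hI
  have hbound : ∀ m, hilbF I m ≤ schemeDeg I := by
    intro m
    obtain ⟨k, hk, hmk⟩ := (hev.and (eventually_ge_atTop m)).exists
    exact hk ▸ hmono hmk
  have hlt : hilbF I 1 < schemeDeg I := by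
    refine lt_of_le_of_ne (hbound 1) fun heq => ?_
    have := schemeDeg_le_of_secant hI hJ (hev.mono fun m hm => hm.trans heq.symm)
    omega
  have hne : hilbF I 1 ≠ 0 := by
    intro h0
    have hrn := hilbF_add_finrank I 1
    have hX : homogeneousSubmodule (Fin (n+1)) K 1 ≤ I.restrictScalars K := by
      rw [← inf_eq_right]
      exact Submodule.eq_of_le_of_finrank_eq inf_le_right (by omega)
    have hone : irrelevantIdeal K n ≤ I := by
      refine Ideal.span_le.2 ?_
      rintro _ ⟨i, rfl⟩
      exact hX (isHomogeneous_X K i)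
    have htop : I = ⊤ := by
      rw [Ideal.eq_top_iff_one, ← hI]
      refine colon_irrelevantIdeal_pow_le_saturate I 1 (Submodule.mem_colon.2 fun g hg => ?_)
      rw [pow_one] at hg
      simpa using hone hg
    obtain ⟨m, hm⟩ := hev.exists
    have hrn' := hilbF_add_finrank I m
    rw [htop, Submodule.restrictScalars_top, top_inf_eq, ← htop] at hrn'
    omega
  have hrn := hilbF_add_finrank I 1
  rw [finrank_homogeneousSubmodule_one] at hrn
  refine Nat.sInf_le ⟨Ideal.span
    ((I.restrictScalars K ⊓ homogeneousSubmodule (Fin (n+1)) K 1 : Submodule K _) : Set _),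
    ⟨_, inf_le_right, ?_, rfl⟩, ?_⟩
  · rw [spanDim]
    omega
  · have hsup : I ⊔ Ideal.span ((I.restrictScalars K ⊓
        homogeneousSubmodule (Fin (n+1)) K 1 : Submodule K _) : Set _) = I :=
      sup_eq_left.2 (Ideal.span_le.2 fun x hx => hx.1)
    rw [interIdeal, hsup, hI, spanDim]
    omega

end

end FiniteScheme

/-- Lemma 3.3.(3). -/
theorem stmt8 (K : Type) [Field K] [IsAlgClosed K] [CharZero K] (n d : ℕ)
    (I : Ideal (MvPolynomial (Fin (n+1)) K))
    (hfin : IsFiniteSubscheme I) (hnd : NondegenerateScheme I)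
    (hdeg : schemeDeg I = d)
    (hlow : ⌈((d : ℚ) - n - 1) / ((tInv I : ℚ) + 1)⌉ + 3 ≤ (schemeReg I : ℤ))
    (hhigh : (schemeReg I : ℤ) ≤ ⌈((d : ℚ) - n - 1) / (tInv I : ℚ)⌉ + 2)
    (f : MvPolynomial (Fin (n+1)) K) (hf0 : f ≠ 0) (hfh : f.IsHomogeneous 1)
    (hsec : n + 1 ≤ schemeDeg (interIdeal I (Ideal.span {f})))
    (hregH : schemeReg (interIdeal I (Ideal.span {f})) < schemeReg I) :
    (schemeDeg (residualIdeal I f) : ℤ) - (spanDim (residualIdeal I f) : ℤ)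
        + (tInv (residualIdeal I f) : ℤ) ≤ (d : ℤ) - n - 1 := by
  have hsatR := FiniteScheme.saturate_residualIdeal hfin.saturated f
  obtain ⟨d', -, hd'⟩ := hfin.finite
  have hevI := FiniteScheme.eventually_hilbF_eq_schemeDeg ⟨d', hd'⟩
  have hevH := FiniteScheme.eventually_hilbF_eq_schemeDeg_of_pos
    (show 0 < schemeDeg (interIdeal I (Ideal.span {f})) by omega)
  have hres := FiniteScheme.hilbF_residualIdeal_add_le I hfh
  have hmono := FiniteScheme.hilbF_monotone hsatR
  have hle : ∀ m, hilbF (residualIdeal I f) m + (n + 1) ≤ d := by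
    intro m
    obtain ⟨k, hk, hmk⟩ := ((hevI.and hevH).and (eventually_ge_atTop (m + 1))).exists
    obtain ⟨j, rfl⟩ : ∃ j, k = j + 1 := ⟨k - 1, by omega⟩
    have h1 := hres j
    have h2 := hmono (show m ≤ j by omega)
    omega
  have hfinR : ∃ r : ℕ, ∀ᶠ m : ℕ in atTop, hilbF (residualIdeal I f) m = r := by
    have hbdd : BddAbove (Set.range (hilbF (residualIdeal I f))) :=
      ⟨d, by rintro _ ⟨m, rfl⟩; have := hle m; omega⟩
    obtain ⟨m₀, hm₀⟩ := Nat.sSup_mem (Set.range_nonempty _) hbdd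
    refine ⟨_, eventually_atTop.2 ⟨m₀, fun m hm => le_antisymm (le_csSup hbdd ⟨m, rfl⟩) ?_⟩⟩
    rw [← hm₀]
    exact hmono hm
  obtain ⟨m, hm⟩ := (FiniteScheme.eventually_hilbF_eq_schemeDeg hfinR).exists
  have h1 := hle m
  have h2 := FiniteScheme.tInv_le_spanDim hsatR hfinR
  omega
end
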